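/- Let w̃ ∈ (ZZ) or (PZZ) and d = dec_Z(w̃). Then d is a decorated diagram with a(d) = 1, and d has at least one ▲ on the first propagating edge and at least one △ on the last propagating edge. -/

import Mathlib

namespace BCF
open List

/-! ### Coxeter matrices of types `A_{n+1}` and `C̃_n`.

Generators are indexed by `Fin (n+1)`, with index `i` corresponding to the
generator `s_{i+1}` (resp. `s̃_{i+1}`) of the paper. -/

/-- Entries of the Coxeter matrix of affine type `C̃ₙ` (on indices `0, …, n`). -/
def cval (n a b : ℕ) : ℕ :=
  if a = b then 1
  else if max a b = min a b + 1 then (if min a b = 0 ∨ max a b = n then 4 else 3)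
  else 2

/-- Entries of the Coxeter matrix of type `A_{n+1}` (on indices `0, …, n`). -/
def aval (a b : ℕ) : ℕ :=
  if a = b then 1 else if max a b = min a b + 1 then 3 else 2

lemma cval_symm (n a b : ℕ) : cval n a b = cval n b a := by
  unfold cval
  rcases eq_or_ne a b with h | h
  · simp [h]
  · rw [if_neg h, if_neg (Ne.symm h), Nat.max_comm b a, Nat.min_comm b a]

lemma aval_symm (a b : ℕ) : aval a b = aval b a := by
  unfold aval
  rcases eq_or_ne a b with h | h
  · simp [h]
  · rw [if_neg h, if_neg (Ne.symm h), Nat.max_comm b a, Nat.min_comm b a]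

lemma cval_ne_one (n a b : ℕ) (h : a ≠ b) : cval n a b ≠ 1 := by
  unfold cval
  rw [if_neg h]
  split <;> [skip; omega]
  split <;> omega

lemma aval_ne_one (a b : ℕ) (h : a ≠ b) : aval a b ≠ 1 := by
  unfold aval
  rw [if_neg h]
  split <;> omega

/-- The Coxeter matrix of type `C̃ₙ` on the generator set `{s̃₁, …, s̃ₙ₊₁}`. -/
def CMat (n : ℕ) : CoxeterMatrix (Fin (n + 1)) where
  M := Matrix.of fun i j => cval n i.val j.val
  isSymm := by
    unfold Matrix.IsSymm
    ext i j
    exact cval_symm n j i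
  diagonal i := by simp [cval]
  off_diagonal i j h := cval_ne_one n i j (fun hc => h (Fin.ext hc))

/-- The Coxeter matrix of type `A_{n+1}` on the generator set `{s₁, …, sₙ₊₁}`. -/
def AMat (n : ℕ) : CoxeterMatrix (Fin (n + 1)) where
  M := Matrix.of fun i j => aval i.val j.val
  isSymm := by
    unfold Matrix.IsSymm
    ext i j
    exact aval_symm j i
  diagonal i := by simp [aval]
  off_diagonal i j h := aval_ne_one i j (fun hc => h (Fin.ext hc))

/-- The Coxeter group of type `C̃ₙ`. -/
abbrev WC (n : ℕ) : Type := (CMat n).Group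

/-- The Coxeter group of type `A_{n+1}`. -/
abbrev WA (n : ℕ) : Type := (AMat n).Group

/-- The Coxeter system of type `C̃ₙ`. -/
def csC (n : ℕ) : CoxeterSystem (CMat n) (WC n) := (CMat n).toCoxeterSystem

/-- The Coxeter system of type `A_{n+1}`. -/
def csA (n : ℕ) : CoxeterSystem (AMat n) (WA n) := (AMat n).toCoxeterSystem

/-! ### Commutation moves and fully commutative elements -/

/-- One commutation move: swap two adjacent commuting letters. -/
def CommMove {B : Type*} (Mx : CoxeterMatrix B) (l l' : List B) : Prop :=
  ∃ (u v : List B) (i j : B), Mx.M i j = 2 ∧ l = u ++ i :: j :: v ∧ l' = u ++ j :: i :: v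

/-- Two words are in the same commutation class. -/
def CommEquiv {B : Type*} (Mx : CoxeterMatrix B) : List B → List B → Prop :=
  Relation.ReflTransGen (CommMove Mx)

/-- An element of a Coxeter group is *fully commutative* (FC) if any reduced
expression for it can be obtained from any other by commutation moves only. -/
def IsFC {B : Type*} {W : Type*} [Group W] {Mx : CoxeterMatrix B}
    (cs : CoxeterSystem Mx W) (w : W) : Prop :=
  ∀ l l' : List B, cs.IsReduced l → cs.wordProd l = w →
    cs.IsReduced l' → cs.wordProd l' = w → CommEquiv Mx l l'

/-! ### The Temperley–Lieb algebra of type `A_{n+1}` -/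

noncomputable section

/-- The defining relations of the Temperley–Lieb algebra `TL(A_{n+1})`
over `ℤ[δ]`: (a1) `bᵢ² = δ bᵢ`; (a2) `bᵢbⱼ = bⱼbᵢ` for `|i-j| > 1`;
(a3) `bᵢbⱼbᵢ = bᵢ` for `|i-j| = 1`. -/
inductive TLRel (n : ℕ) :
    FreeAlgebra (Polynomial ℤ) (Fin (n + 1)) → FreeAlgebra (Polynomial ℤ) (Fin (n + 1)) → Prop
  | sq (i : Fin (n + 1)) :
      TLRel n (FreeAlgebra.ι (Polynomial ℤ) i * FreeAlgebra.ι (Polynomial ℤ) i)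
        ((Polynomial.X : Polynomial ℤ) • FreeAlgebra.ι (Polynomial ℤ) i)
  | comm (i j : Fin (n + 1)) (h : aval i.val j.val = 2) :
      TLRel n (FreeAlgebra.ι (Polynomial ℤ) i * FreeAlgebra.ι (Polynomial ℤ) j)
        (FreeAlgebra.ι (Polynomial ℤ) j * FreeAlgebra.ι (Polynomial ℤ) i)
  | braid (i j : Fin (n + 1)) (h : aval i.val j.val = 3) :
      TLRel n (FreeAlgebra.ι (Polynomial ℤ) i * FreeAlgebra.ι (Polynomial ℤ) j *
          FreeAlgebra.ι (Polynomial ℤ) i)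
        (FreeAlgebra.ι (Polynomial ℤ) i)

/-- The Temperley–Lieb algebra `TL(A_{n+1})` as a quotient of the free
`ℤ[δ]`-algebra on the generators `b₁, …, b_{n+1}`. -/
abbrev TLA (n : ℕ) : Type := RingQuot (TLRel n)

/-- The generator `b_{i+1}` of `TL(A_{n+1})`. -/
def tlGen (n : ℕ) (i : Fin (n + 1)) : TLA n :=
  RingQuot.mkAlgHom (Polynomial ℤ) (TLRel n) (FreeAlgebra.ι (Polynomial ℤ) i)

/-- The product `b_{i₁} ⋯ b_{i_k}` in `TL(A_{n+1})` associated with a word. -/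
def bProd (n : ℕ) (l : List (Fin (n + 1))) : TLA n := (l.map (tlGen n)).prod

/-- The element `δ` of `TL(A_{n+1})`. -/
def tlδ (n : ℕ) : TLA n := algebraMap (Polynomial ℤ) (TLA n) Polynomial.X

end

end BCF

namespace BCF

/-! ### Temperley–Lieb diagrams via stackings of simple diagrams.

A node of the standard `(n+2)`-box is `Sum.inl p` (the north node `p+1`) or
`Sum.inr p` (the south node `(p+1)'`).  The (loop-free part of the) diagram
`d_{i₁} ⋯ d_{i_k}` associated with a word is described through connectivity in the
stacking of the corresponding simple diagrams. -/

/-- Nodes of the standard `(n+2)`-box. -/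
abbrev Node (n : ℕ) := Fin (n + 2) ⊕ Fin (n + 2)

/-- The cup/cap of the simple diagram `d_{i+1}` occupies positions `i` and `i+1`. -/
def cupAt (n : ℕ) (i : Fin (n + 1)) (p q : Fin (n + 2)) : Prop :=
  (p.val = i.val ∧ q.val = i.val + 1) ∨ (q.val = i.val ∧ p.val = i.val + 1)

/-- One step along a curve of the stacking of the simple diagrams of the word `l`:
vertices are pairs (interface, position), where interface `t` lies between the
`t`-th and `(t+1)`-st simple diagram. -/
inductive LStep (n : ℕ) (l : List (Fin (n + 1))) :
    ℕ × Fin (n + 2) → ℕ × Fin (n + 2) → Prop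
  | cupN {t : ℕ} {p q : Fin (n + 2)} (ht : t < l.length)
      (h : cupAt n (l.get ⟨t, ht⟩) p q) : LStep n l (t, p) (t, q)
  | capS {t : ℕ} {p q : Fin (n + 2)} (ht : t < l.length)
      (h : cupAt n (l.get ⟨t, ht⟩) p q) : LStep n l (t + 1, p) (t + 1, q)
  | vert {t : ℕ} {p : Fin (n + 2)} (ht : t < l.length)
      (h : p.val ≠ (l.get ⟨t, ht⟩).val ∧ p.val ≠ (l.get ⟨t, ht⟩).val + 1) :
      LStep n l (t, p) (t + 1, p)

/-- Two points of the stacking lie on the same curve. -/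
def Conn (n : ℕ) (l : List (Fin (n + 1))) :
    ℕ × Fin (n + 2) → ℕ × Fin (n + 2) → Prop :=
  Relation.ReflTransGen (fun a b => LStep n l a b ∨ LStep n l b a)

/-- The boundary points of the stacking of the word `l`. -/
def bd (n : ℕ) (l : List (Fin (n + 1))) : Node n → ℕ × Fin (n + 2)
  | Sum.inl p => (0, p)
  | Sum.inr p => (l.length, p)

/-- `(h, k)` is an edge of the (loop-free) diagram of the word `l`. -/
def WordEdge (n : ℕ) (l : List (Fin (n + 1))) (h k : Node n) : Prop :=
  h ≠ k ∧ Conn n l (bd n l h) (bd n l k)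

/-- A point of the stacking lying on a loop (a closed curve missing the boundary). -/
def LoopVert (n : ℕ) (l : List (Fin (n + 1))) (v : ℕ × Fin (n + 2)) : Prop :=
  v.1 ≤ l.length ∧ ∀ h : Node n, ¬ Conn n l v (bd n l h)

/-- The number of loops of the diagram of the word `l`. -/
noncomputable def loopCount (n : ℕ) (l : List (Fin (n + 1))) : ℕ :=
  Nat.card (Quot (fun a b : { v // LoopVert n l v } => Conn n l a.1 b.1))

/-! ### Heaps, alternating heaps, forks and snake paths.

The heap of a word `l : List (Fin (n+1))` has underlying set `Fin l.length`,
with `e` labelled by the generator `l.get e`; its order is the transitive closure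
of the relation `e ≺ f` for `e` occurring before `f` with non-commuting labels.
Heaps are drawn from top to bottom. -/

/-- Non-commuting generators (equal or adjacent indices). -/
def nonComm {n : ℕ} (a b : Fin (n + 1)) : Prop :=
  a = b ∨ a.val + 1 = b.val ∨ b.val + 1 = a.val

section Heap

variable (n : ℕ) (l : List (Fin (n + 1)))

/-- The column (0-indexed) of an element of the heap of `l`. -/
def colOf (e : Fin l.length) : ℕ := (l.get e).val

/-- The heap order: `e` lies (strictly) above `f` in the heap of `l`. -/
def hLt (e f : Fin l.length) : Prop :=
  Relation.TransGen (fun a b : Fin l.length => a < b ∧ nonComm (l.get a) (l.get b)) e f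

/-- `f` covers `e` in the heap order (a Hasse edge, `e` above `f`). -/
def hCov (e f : Fin l.length) : Prop :=
  hLt n l e f ∧ ∀ g, ¬(hLt n l e g ∧ hLt n l g f)

/-- Adjacent columns. -/
def adjCol (e f : Fin l.length) : Prop :=
  colOf n l e + 1 = colOf n l f ∨ colOf n l f + 1 = colOf n l e

/-- A step of an up-down path: a Hasse edge between adjacent columns. -/
def HasseStep (e f : Fin l.length) : Prop :=
  adjCol n l e f ∧ (hCov n l e f ∨ hCov n l f e)

/-- `(a, c, b)` is a fork (a convex subheap with label sequence
`s̃_{i} s̃_{i±1} s̃_{i}`, with `a` its top node and `b` its bottom node). -/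
def ForkNodes (a c b : Fin l.length) : Prop :=
  hLt n l a c ∧ hLt n l c b ∧ colOf n l a = colOf n l b ∧ adjCol n l a c ∧
    ∀ g, hLt n l a g → hLt n l g b → g = c

/-- A left fork `s̃₁ s̃₂ s̃₁`. -/
def LeftForkN (a c b : Fin l.length) : Prop := ForkNodes n l a c b ∧ colOf n l a = 0

/-- A right fork `s̃ₙ₊₁ s̃ₙ s̃ₙ₊₁`. -/
def RightForkN (a c b : Fin l.length) : Prop := ForkNodes n l a c b ∧ colOf n l a = n

/-- A jump of a snake path between the two outer nodes of a left or right fork. -/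
def JumpStep (e f : Fin l.length) : Prop :=
  (colOf n l e = 0 ∨ colOf n l e = n) ∧
    ∃ c, ForkNodes n l e c f ∨ ForkNodes n l f c e

/-- A step of a snake path. -/
def SnakeStep (e f : Fin l.length) : Prop := HasseStep n l e f ∨ JumpStep n l e f

/-- Local conditions on three consecutive elements of a snake path: two consecutive
Hasse steps keep the horizontal direction and alternate the vertical direction;
jumps are isolated and the fork partner lies on the correct side (conditions (a)
and (b) of the snake algorithm). -/
def TripleOK (p : List (Fin l.length)) : Prop :=
  ∀ (t : ℕ) (h : t + 2 < p.length),
    ((adjCol n l (p[t]'(by omega)) (p[t+1]'(by omega)) ∧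
        adjCol n l (p[t+1]'(by omega)) (p[t+2]'h) ) →
      ((colOf n l (p[t]'(by omega)) < colOf n l (p[t+1]'(by omega)) ↔
          colOf n l (p[t+1]'(by omega)) < colOf n l (p[t+2]'h)) ∧
        (hLt n l (p[t]'(by omega)) (p[t+1]'(by omega)) ↔
          hLt n l (p[t+2]'h) (p[t+1]'(by omega))))) ∧
    (colOf n l (p[t]'(by omega)) = colOf n l (p[t+1]'(by omega)) →
      (adjCol n l (p[t+1]'(by omega)) (p[t+2]'h) ∧
        (hLt n l (p[t+1]'(by omega)) (p[t]'(by omega)) →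
          hLt n l (p[t+1]'(by omega)) (p[t+2]'h)) ∧
        (hLt n l (p[t]'(by omega)) (p[t+1]'(by omega)) →
          hLt n l (p[t+2]'h) (p[t+1]'(by omega))))) ∧
    (colOf n l (p[t+1]'(by omega)) = colOf n l (p[t+2]'h) →
      (adjCol n l (p[t]'(by omega)) (p[t+1]'(by omega)) ∧
        (hLt n l (p[t]'(by omega)) (p[t+1]'(by omega)) →
          hLt n l (p[t+2]'h) (p[t+1]'(by omega))) ∧
        (hLt n l (p[t+1]'(by omega)) (p[t]'(by omega)) →
          hLt n l (p[t+1]'(by omega)) (p[t+2]'h))))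

/-- At a jump, the horizontal direction of the path is reversed. -/
def QuadOK (p : List (Fin l.length)) : Prop :=
  ∀ (t : ℕ) (h : t + 3 < p.length),
    colOf n l (p[t+1]'(by omega)) = colOf n l (p[t+2]'(by omega)) →
      (colOf n l (p[t]'(by omega)) < colOf n l (p[t+1]'(by omega)) ↔
        colOf n l (p[t+3]'h) < colOf n l (p[t+2]'(by omega)))

/-- `f` continues the snake path arriving at `e0` via the step `e1 → e0`
(same horizontal direction, alternating vertical direction). -/
def ContStep (e1 e0 f : Fin l.length) : Prop :=
  HasseStep n l e0 f ∧
    (colOf n l e0 = colOf n l e1 + 1 ↔ colOf n l f = colOf n l e0 + 1) ∧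
    (hLt n l e1 e0 ↔ hLt n l f e0)

/-- The path arriving at `e0` via `e1 → e0` can be continued through a left or
right fork at `e0` (cases (a), (b) of step (UD1) of the snake algorithm). -/
def JumpCont (e1 e0 : Fin l.length) : Prop :=
  (colOf n l e0 = 0 ∨ colOf n l e0 = n) ∧
    ∃ c f, (hLt n l e1 e0 ∧ ForkNodes n l f c e0) ∨ (hLt n l e0 e1 ∧ ForkNodes n l e0 c f)

/-- The snake path stops at `e0` (arriving via `e1 → e0`). -/
def TerminalAt (e1 e0 : Fin l.length) : Prop :=
  (¬∃ f, ContStep n l e1 e0 f) ∧ ¬JumpCont n l e1 e0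

/-- `p` is (the list of nodes of) a snake path `γ(H, f)` produced by the snake
algorithm from a left or right fork, which is not a cycle. -/
structure IsForkSnake (p : List (Fin l.length)) : Prop where
  chain : List.Chain' (SnakeStep n l) p
  nodup : p.Nodup
  triple : TripleOK n l p
  quad : QuadOK n l p
  hasJump : ∃ (t : ℕ) (h : t + 1 < p.length),
    colOf n l (p[t]'(by omega)) = colOf n l (p[t+1]'h)
  ends : ∃ e0 e1 r f0 f1 s, p = e0 :: e1 :: r ∧ p.reverse = f0 :: f1 :: s ∧
    adjCol n l e0 e1 ∧ adjCol n l f0 f1 ∧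
    TerminalAt n l e1 e0 ∧ TerminalAt n l f1 f0

/-- The snake path `γ(H, f)` is the cycle `γ∞`. -/
def IsSnakeCycle (p : List (Fin l.length)) : Prop :=
  2 ≤ p.length ∧ p.Nodup ∧
    List.Chain' (SnakeStep n l) (p ++ p.take 2) ∧
    TripleOK n l (p ++ p.take 2) ∧ QuadOK n l (p ++ p.take 3)

/-- A (non-degenerate) snake path `γ_{→x,y}` not coming from a fork: a maximal
rightward up-down path. -/
structure IsFreeSnake (p : List (Fin l.length)) : Prop where
  chain : List.Chain' (HasseStep n l) p
  nodup : p.Nodup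
  rightward : ∀ (t : ℕ) (h : t + 1 < p.length),
    colOf n l (p[t]'(by omega)) + 1 = colOf n l (p[t+1]'h)
  alt : ∀ (t : ℕ) (h : t + 2 < p.length),
    hLt n l (p[t]'(by omega)) (p[t+1]'(by omega)) ↔
      hLt n l (p[t+2]'h) (p[t+1]'(by omega))
  ends : ∃ e0 e1 r f0 f1 s, p = e0 :: e1 :: r ∧ p.reverse = f0 :: f1 :: s ∧
    TerminalAt n l e1 e0 ∧ TerminalAt n l f1 f0

open Classical in
/-- The node of the standard `(n+2)`-box associated with the endpoint `e0` of a
snake path coming from a fork, where `e1 → e0` is the arrival step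
(Definition of `(h,k)_γ`, case (a)). -/
noncomputable def endNodeOf (e0 e1 : Fin l.length) : Node n :=
  if colOf n l e0 = colOf n l e1 + 1 then
    -- the arrival step goes rightward
    (if hLt n l e1 e0 then
      Sum.inl ⟨colOf n l e0 + 1, by have h := (l.get e0).isLt; unfold colOf; omega⟩
    else
      Sum.inr ⟨colOf n l e0 + 1, by have h := (l.get e0).isLt; unfold colOf; omega⟩)
  else
    -- the arrival step goes leftward
    (if hLt n l e1 e0 then
      Sum.inl ⟨colOf n l e0, by have h := (l.get e0).isLt; unfold colOf; omega⟩
    else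
      Sum.inr ⟨colOf n l e0, by have h := (l.get e0).isLt; unfold colOf; omega⟩)

/-- The pair of box nodes `(h, k)` associated with a fork snake path `p`:
`h` comes from the head of `p` and `k` from its last node. -/
def SnakeHK (p : List (Fin l.length)) (h k : Node n) : Prop :=
  ∃ e0 e1 r f0 f1 s, p = e0 :: e1 :: r ∧ p.reverse = f0 :: f1 :: s ∧
    h = endNodeOf n l e0 e1 ∧ k = endNodeOf n l f0 f1

open Classical in
/-- The node associated with the starting point of a free snake path
(Definition of `(h,k)_γ`, case (b)). -/
noncomputable def freeStartNode (e0 e1 : Fin l.length) : Node n :=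
  if hLt n l e1 e0 then
    Sum.inl ⟨colOf n l e0, by have h := (l.get e0).isLt; unfold colOf; omega⟩
  else
    Sum.inr ⟨colOf n l e0, by have h := (l.get e0).isLt; unfold colOf; omega⟩

open Classical in
/-- The node associated with the final point of a free snake path
(Definition of `(h,k)_γ`, case (b)); `f0` is the last node and `f1` the previous one. -/
noncomputable def freeEndNode (f0 f1 : Fin l.length) : Node n :=
  if hLt n l f1 f0 then
    Sum.inl ⟨colOf n l f0 + 1, by have h := (l.get f0).isLt; unfold colOf; omega⟩
  else
    Sum.inr ⟨colOf n l f0 + 1, by have h := (l.get f0).isLt; unfold colOf; omega⟩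

/-- The pair of box nodes `(h, k)` associated with a free snake path. -/
def FreeHK (p : List (Fin l.length)) (h k : Node n) : Prop :=
  ∃ e0 e1 r f0 f1 s, p = e0 :: e1 :: r ∧ p.reverse = f0 :: f1 :: s ∧
    h = freeStartNode n l e0 e1 ∧ k = freeEndNode n l f0 f1

end Heap

/-- The linear order `1 ≻ₗ 2 ≻ₗ … ≻ₗ n+2 ≻ₗ (n+2)' ≻ₗ … ≻ₗ 1'` on the nodes of the
standard `(n+2)`-box: `h ≻ₗ k` iff `lrank h < lrank k`. -/
def lrank (n : ℕ) : Node n → ℕ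
  | Sum.inl p => p.val
  | Sum.inr p => (n + 2) + (n + 1 - p.val)

/-- The linear order `n+2 ≻ᵣ … ≻ᵣ 1 ≻ᵣ 1' ≻ᵣ … ≻ᵣ (n+2)'` on the nodes of the
standard `(n+2)`-box: `h ≻ᵣ k` iff `rrank h < rrank k`. -/
def rrank (n : ℕ) : Node n → ℕ
  | Sum.inl p => n + 1 - p.val
  | Sum.inr p => (n + 2) + p.val

/-- `H(w̃)` is alternating: for all non-commuting generators `s, t` the chain
`H_{{s,t}}` has alternating labels. -/
def AltWord (n : ℕ) (l : List (Fin (n + 1))) : Prop :=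
  ∀ x : ℕ, x + 1 ≤ n →
    List.Chain' (· ≠ ·) (l.filter (fun i => decide (i.val = x ∨ i.val = x + 1)))

/-- `w̃ ∈ (ALT)`: a fully commutative element with alternating heap. -/
def IsALT (n : ℕ) (w : WC n) : Prop :=
  IsFC (csC n) w ∧
    ∃ l, (csC n).IsReduced l ∧ (csC n).wordProd l = w ∧ AltWord n l

end BCF

namespace BCF

/-! ### Decorated diagrams and the decoration algorithms -/

/-- The decorations `•`, `▲`, `∘`, `△`. -/
inductive Deco : Type
  | dot | btri | circ | wtri
deriving DecidableEq

/-- A decorated diagram in the standard `(n+2)`-box: an underlying matching of the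
nodes, a number of (decorated) loops, a decoration sequence on each (oriented) edge,
and the relative vertical order of the decorations (used for diagrams with a unique
non-propagating edge in each face). -/
structure DecDiagram (n : ℕ) : Type where
  edge : Node n → Node n → Prop
  loops : ℕ
  decs : Node n × Node n → List Deco
  vorder : List ((Node n × Node n) × Deco)

/-- The eastmost position of the box. -/
def topIdx (n : ℕ) : Fin (n + 2) := Fin.last (n + 1)

/-- The decoration prescribed at an end of an edge by step (D4) of the decoration
algorithm: a `•` at the nodes `1, 1'`, a `∘` at the nodes `n+2, (n+2)'`. -/
def endDeco (n : ℕ) (x : Node n) : List Deco :=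
  if x = Sum.inl (0 : Fin (n + 2)) ∨ x = Sum.inr (0 : Fin (n + 2)) then [Deco.dot]
  else if x = Sum.inl (topIdx n) ∨ x = Sum.inr (topIdx n) then [Deco.circ]
  else []

/-- The extreme vertical edges `(1, 1')` and `(n+2, (n+2)')`, which are left
undecorated by the decoration algorithm for alternating heaps. -/
def IsExtremeVertical (n : ℕ) (h k : Node n) : Prop :=
  (h = Sum.inl (0 : Fin (n + 2)) ∧ k = Sum.inr (0 : Fin (n + 2))) ∨
  (h = Sum.inr (0 : Fin (n + 2)) ∧ k = Sum.inl (0 : Fin (n + 2))) ∨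
  (h = Sum.inl (topIdx n) ∧ k = Sum.inr (topIdx n)) ∨
  (h = Sum.inr (topIdx n) ∧ k = Sum.inl (topIdx n))

/-- The sequence of decorations produced by step (D2) along a snake path: one `▲`
for each left fork crossed and one `△` for each right fork crossed, in order. -/
def triSeq (n : ℕ) (l : List (Fin (n + 1))) (p : List (Fin l.length)) : List Deco :=
  (p.zip p.tail).filterMap fun ef =>
    if colOf n l ef.1 = colOf n l ef.2 then
      (if colOf n l ef.1 = 0 then some Deco.btri else some Deco.wtri)
    else none

open Classical in
/-- The triangle decorations carried by the edge `(h,k)` of `d_{τ(w̃)}`: the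
decorations collected along the snake path of a fork with associated edge `(h,k)`,
if there is one. -/
noncomputable def coreDecs (n : ℕ) (l : List (Fin (n + 1))) (h k : Node n) :
    List Deco :=
  if hp : ∃ p : List (Fin l.length), IsForkSnake n l p ∧ SnakeHK n l p h k then
    triSeq n l hp.choose
  else []

open Classical in
/-- The full decoration sequence placed on the pair `(h,k)` by the decoration
algorithm for alternating heaps. -/
noncomputable def altDecs (n : ℕ) (l : List (Fin (n + 1))) (h k : Node n) :
    List Deco :=
  if ¬WordEdge n l h k then []
  else if IsExtremeVertical n h k then []
  else endDeco n h ++ coreDecs n l h k ++ endDeco n k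

/-- `d` is the decorated diagram `dec_A` produced from the word `l` (an alternating
reduced word) by the decoration algorithm for alternating heaps:  the underlying
diagram is `d_{τ(w̃)}`, there are `α(w̃)` decorated loops, each edge associated with a
fork snake path carries its triangle decorations in order, and a `•` (resp. `∘`) is
prepended at the ends incident to the nodes `1, 1'` (resp. `n+2, (n+2)'`). -/
def DecASpecWord (n : ℕ) (l : List (Fin (n + 1))) (d : DecDiagram n) : Prop :=
  (∀ h k, d.edge h k ↔ WordEdge n l h k) ∧
  d.loops = loopCount n l ∧
  d.vorder = [] ∧
  ∀ h k, d.decs (h, k) = altDecs n l h k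

/-- `d = dec_A(w̃)` for the alternating element `w̃`. -/
def DecASpec (n : ℕ) (w : WC n) (d : DecDiagram n) : Prop :=
  ∀ l, (csC n).IsReduced l → (csC n).wordProd l = w → DecASpecWord n l d

/-! ### The families (LP), (RP), (LRP), (ZZ), (PZZ) -/

/-- `w̃ ∈ (LP)` with left-peak index `j_ℓ = J + 1` (so `J` is the 0-indexed column of
`s̃_{j_ℓ}`). -/
def LPwith (n : ℕ) (J : ℕ) (w : WC n) : Prop :=
  1 ≤ J ∧ J + 1 ≤ n ∧ IsFC (csC n) w ∧
  ∃ l, (csC n).IsReduced l ∧ (csC n).wordProd l = w ∧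
    -- (1) the subheap on the labels `s̃₁, …, s̃_{j_ℓ}` is the left peak
    -- `P_←(s̃_{j_ℓ})`:
    (∃ l₁, CommEquiv (CMat n) (l.filter fun i => decide (i.val ≤ J)) l₁ ∧
      l₁.map Fin.val = (List.range (J + 1)).reverse ++ List.range' 1 J) ∧
    -- (2) there is no `s̃_{j_ℓ+1}`-element between the two `s̃_{j_ℓ}`-elements:
    (¬∃ u v w', (l.filter fun i => decide (i.val = J ∨ i.val = J + 1)).map Fin.val =
        u ++ [J] ++ v ++ [J] ++ w' ∧ (J + 1) ∈ v) ∧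
    -- (3) the subheap on the labels `s̃_{j_ℓ}, …, s̃ₙ₊₁` is alternating once one
    -- `s̃_{j_ℓ}`-element is deleted:
    (∃ (l₂ u v : List (Fin (n + 1))) (e : Fin (n + 1)),
      CommEquiv (CMat n) (l.filter fun i => decide (J ≤ i.val)) l₂ ∧
      l₂ = u ++ e :: v ∧ e.val = J ∧ AltWord n (u ++ v))

/-- `w̃ ∈ (RP)` with right-peak index `j_r = K + 1`. -/
def RPwith (n : ℕ) (K : ℕ) (w : WC n) : Prop :=
  1 ≤ K ∧ K + 1 ≤ n ∧ IsFC (csC n) w ∧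
  ∃ l, (csC n).IsReduced l ∧ (csC n).wordProd l = w ∧
    (∃ l₁, CommEquiv (CMat n) (l.filter fun i => decide (K ≤ i.val)) l₁ ∧
      l₁.map Fin.val = List.range' K (n - K + 1) ++ (List.range' K (n - K)).reverse) ∧
    (¬∃ u v w', (l.filter fun i => decide (i.val = K ∨ i.val + 1 = K)).map Fin.val =
        u ++ [K] ++ v ++ [K] ++ w' ∧ (K - 1) ∈ v) ∧
    (∃ (l₂ u v : List (Fin (n + 1))) (e : Fin (n + 1)),
      CommEquiv (CMat n) (l.filter fun i => decide (i.val ≤ K)) l₂ ∧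
      l₂ = u ++ e :: v ∧ e.val = K ∧ AltWord n (u ++ v))

/-- `w̃ ∈ (LRP)` with peak indices `j_ℓ = J + 1 < j_r = K + 1`. -/
def LRPwith (n : ℕ) (J K : ℕ) (w : WC n) : Prop :=
  1 ≤ J ∧ J < K ∧ K + 1 ≤ n ∧ IsFC (csC n) w ∧
  ∃ l, (csC n).IsReduced l ∧ (csC n).wordProd l = w ∧
    -- LP(1), LP(2):
    (∃ l₁, CommEquiv (CMat n) (l.filter fun i => decide (i.val ≤ J)) l₁ ∧
      l₁.map Fin.val = (List.range (J + 1)).reverse ++ List.range' 1 J) ∧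
    (¬∃ u v w', (l.filter fun i => decide (i.val = J ∨ i.val = J + 1)).map Fin.val =
        u ++ [J] ++ v ++ [J] ++ w' ∧ (J + 1) ∈ v) ∧
    -- RP(1), RP(2):
    (∃ l₁, CommEquiv (CMat n) (l.filter fun i => decide (K ≤ i.val)) l₁ ∧
      l₁.map Fin.val = List.range' K (n - K + 1) ++ (List.range' K (n - K)).reverse) ∧
    (¬∃ u v w', (l.filter fun i => decide (i.val = K ∨ i.val + 1 = K)).map Fin.val =
        u ++ [K] ++ v ++ [K] ++ w' ∧ (K - 1) ∈ v) ∧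
    -- the subheap on the labels `s̃_{j_ℓ}, …, s̃_{j_r}` is alternating once one
    -- `s̃_{j_ℓ}`- and one `s̃_{j_r}`-element are deleted:
    (∃ (l₂ u v w' : List (Fin (n + 1))) (e f : Fin (n + 1)),
      CommEquiv (CMat n) (l.filter fun i => decide (J ≤ i.val ∧ i.val ≤ K)) l₂ ∧
      l₂ = u ++ e :: v ++ f :: w' ∧
      ((e.val = J ∧ f.val = K) ∨ (e.val = K ∧ f.val = J)) ∧
      AltWord n (u ++ v ++ w'))

/-- The infinite word `(s̃₁ s̃₂ ⋯ s̃ₙ s̃ₙ₊₁ s̃ₙ ⋯ s̃₂ s̃₁)^∞`, as a function giving the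
(0-indexed) column of its `t`-th letter. -/
def zigv (n t : ℕ) : ℕ := if t % (2 * n) ≤ n then t % (2 * n) else 2 * n - t % (2 * n)

/-- `l` is a finite factor of the infinite word `(s̃₁ s̃₂ ⋯ s̃ₙ₊₁ ⋯ s̃₂ s̃₁)^∞`. -/
def IsZigWord (n : ℕ) (l : List (Fin (n + 1))) : Prop :=
  ∃ k, l.map Fin.val = (List.range l.length).map fun t => zigv n (k + t)

/-- `w̃ ∈ (ZZ)`. -/
def IsZZ (n : ℕ) (w : WC n) : Prop :=
  IsFC (csC n) w ∧
  ∃ l, (csC n).IsReduced l ∧ (csC n).wordProd l = w ∧ IsZigWord n l ∧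
    ∃ i, 1 ≤ i ∧ i + 1 ≤ n ∧ 3 ≤ (l.map Fin.val).count i

/-- `w̃ ∈ (PZZ)`. -/
def IsPZZ (n : ℕ) (w : WC n) : Prop :=
  IsFC (csC n) w ∧
  ∃ l, (csC n).IsReduced l ∧ (csC n).wordProd l = w ∧ IsZigWord n l ∧
    (∀ i, 1 ≤ i → i + 1 ≤ n → (l.map Fin.val).count i < 3) ∧
    (∃ u v, l.map Fin.val = u ++ [1, 0, 1] ++ v) ∧
    (∃ u v, l.map Fin.val = u ++ [n - 1, n, n - 1] ++ v)

/-! ### The decoration algorithm for peaks -/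

/-- `lsr` is a word of the semireduced heap of `l` for a left peak at column `J`
(the subheap on the labels `≥ s̃_{j_ℓ}` with one `s̃_{j_ℓ}`-element deleted). -/
def SemiLP (n J : ℕ) (l lsr : List (Fin (n + 1))) : Prop :=
  ∃ (l₂ u v : List (Fin (n + 1))) (e : Fin (n + 1)),
    CommEquiv (CMat n) (l.filter fun i => decide (J ≤ i.val)) l₂ ∧
    l₂ = u ++ e :: v ∧ e.val = J ∧ lsr = u ++ v

/-- `lsr` is a word of the semireduced heap of `l` for a right peak at column `K`. -/
def SemiRP (n K : ℕ) (l lsr : List (Fin (n + 1))) : Prop :=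
  ∃ (l₂ u v : List (Fin (n + 1))) (e : Fin (n + 1)),
    CommEquiv (CMat n) (l.filter fun i => decide (i.val ≤ K)) l₂ ∧
    l₂ = u ++ e :: v ∧ e.val = K ∧ lsr = u ++ v

/-- `lsr` is a word of the semireduced heap of `l` for a left-right peak. -/
def SemiLRP (n J K : ℕ) (l lsr : List (Fin (n + 1))) : Prop :=
  ∃ (l₂ u v w' : List (Fin (n + 1))) (e f : Fin (n + 1)),
    CommEquiv (CMat n) (l.filter fun i => decide (J ≤ i.val ∧ i.val ≤ K)) l₂ ∧
    l₂ = u ++ e :: v ++ f :: w' ∧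
    ((e.val = J ∧ f.val = K) ∨ (e.val = K ∧ f.val = J)) ∧
    lsr = u ++ v ++ w'

/-- `d` is obtained from `d₀` by adding a `▲` on the edge `(1,1')` (if `lft`) and a
`△` on the edge `(n+2,(n+2)')` (if `rgt`), leaving everything else unchanged
(steps (DP2), (DP3) of the decoration algorithm for peaks). -/
def PAdd (n : ℕ) (d₀ d : DecDiagram n) (lft rgt : Prop) : Prop :=
  (∀ h k, d.edge h k ↔ d₀.edge h k) ∧ d.loops = d₀.loops ∧ d.vorder = d₀.vorder ∧
  (∀ p : Node n × Node n,
    ¬IsExtremeVertical n p.1 p.2 → d.decs p = d₀.decs p) ∧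
  (lft → d.decs (Sum.inl (0 : Fin (n + 2)), Sum.inr (0 : Fin (n + 2))) = [Deco.btri] ∧
    d.decs (Sum.inr (0 : Fin (n + 2)), Sum.inl (0 : Fin (n + 2))) = [Deco.btri]) ∧
  (¬lft → d.decs (Sum.inl (0 : Fin (n + 2)), Sum.inr (0 : Fin (n + 2))) =
      d₀.decs (Sum.inl (0 : Fin (n + 2)), Sum.inr (0 : Fin (n + 2))) ∧
    d.decs (Sum.inr (0 : Fin (n + 2)), Sum.inl (0 : Fin (n + 2))) =
      d₀.decs (Sum.inr (0 : Fin (n + 2)), Sum.inl (0 : Fin (n + 2)))) ∧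
  (rgt → d.decs (Sum.inl (topIdx n), Sum.inr (topIdx n)) = [Deco.wtri] ∧
    d.decs (Sum.inr (topIdx n), Sum.inl (topIdx n)) = [Deco.wtri]) ∧
  (¬rgt → d.decs (Sum.inl (topIdx n), Sum.inr (topIdx n)) =
      d₀.decs (Sum.inl (topIdx n), Sum.inr (topIdx n)) ∧
    d.decs (Sum.inr (topIdx n), Sum.inl (topIdx n)) =
      d₀.decs (Sum.inr (topIdx n), Sum.inl (topIdx n)))

/-- `d = dec_P(w̃)` for `w̃ ∈ (LP) ∪ (RP) ∪ (LRP−Z)`: the decorated diagram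
`dec_A(w̃_sr)` of the semireduced alternating element, with a `▲` added on `(1,1')`
for a left peak and a `△` added on `(n+2,(n+2)')` for a right peak. -/
def DecPSpec (n : ℕ) (w : WC n) (d : DecDiagram n) : Prop :=
  (∃ J, LPwith n J w ∧
    ∃ l lsr d₀, (csC n).IsReduced l ∧ (csC n).wordProd l = w ∧ SemiLP n J l lsr ∧
      DecASpecWord n lsr d₀ ∧ PAdd n d₀ d True False) ∨
  (∃ K, RPwith n K w ∧
    ∃ l lsr d₀, (csC n).IsReduced l ∧ (csC n).wordProd l = w ∧ SemiRP n K l lsr ∧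
      DecASpecWord n lsr d₀ ∧ PAdd n d₀ d False True) ∨
  (∃ J K, LRPwith n J K w ∧ ¬IsPZZ n w ∧
    ∃ l lsr d₀, (csC n).IsReduced l ∧ (csC n).wordProd l = w ∧ SemiLRP n J K l lsr ∧
      DecASpecWord n lsr d₀ ∧ PAdd n d₀ d True True)

/-! ### The decoration algorithm for zigzags -/

open Classical in
/-- A list of `c` copies of the decoration `D`, with the first one replaced by `E`
if `s` holds and the last one replaced by `E` if `e` holds. -/
noncomputable def markEnds (c : ℕ) (s e : Prop) (D E : Deco) : List Deco :=
  List.ofFn fun t : Fin c => if (t.val = 0 ∧ s) ∨ (t.val = c - 1 ∧ e) then E else D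

open Classical in
/-- `d = dec_Z(w̃)` for `w̃ ∈ (ZZ) ∪ (PZZ)`. -/
noncomputable def DecZSpec (n : ℕ) (w : WC n) (d : DecDiagram n) : Prop :=
  ∀ l, (csC n).IsReduced l → (csC n).wordProd l = w →
    (∀ h k, d.edge h k ↔ WordEdge n l h k) ∧ d.loops = 0 ∧
    ∃ a b a' b' : Fin (n + 2),
      -- the first and last propagating edges:
      d.edge (Sum.inl a) (Sum.inr b) ∧ (∀ x y, d.edge (Sum.inl x) (Sum.inr y) → a ≤ x) ∧
      d.edge (Sum.inl a') (Sum.inr b') ∧ (∀ x y, d.edge (Sum.inl x) (Sum.inr y) → x ≤ a') ∧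
      -- (ZZ2)-(ZZ4): one `▲` per occurrence of `s̃₁` on the first propagating edge and
      -- one `△` per occurrence of `s̃ₙ₊₁` on the last one, the extremal ones replaced
      -- by `•`/`∘` when the word starts or ends with `s̃₁`/`s̃ₙ₊₁`:
      d.decs (Sum.inl a, Sum.inr b) =
        markEnds ((l.map Fin.val).count 0)
          ((l.map Fin.val).head? = some 0) ((l.map Fin.val).getLast? = some 0)
          Deco.btri Deco.dot ∧
      d.decs (Sum.inl a', Sum.inr b') =
        markEnds ((l.map Fin.val).count n)
          ((l.map Fin.val).head? = some n) ((l.map Fin.val).getLast? = some n)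
          Deco.wtri Deco.circ ∧
      -- the `•`/`∘` added on the boundary cups:
      ((l.map Fin.val).head? = some 0 →
        ∀ (h1 : (1 : ℕ) < n + 2), d.decs (Sum.inl 0, Sum.inl ⟨1, h1⟩) = [Deco.dot]) ∧
      ((l.map Fin.val).getLast? = some 0 →
        ∀ (h1 : (1 : ℕ) < n + 2), d.decs (Sum.inr 0, Sum.inr ⟨1, h1⟩) = [Deco.dot]) ∧
      ((l.map Fin.val).head? = some n →
        ∀ (h1 : n < n + 2), d.decs (Sum.inl ⟨n, h1⟩, Sum.inl (topIdx n)) = [Deco.circ]) ∧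
      ((l.map Fin.val).getLast? = some n →
        ∀ (h1 : n < n + 2), d.decs (Sum.inr ⟨n, h1⟩, Sum.inr (topIdx n)) = [Deco.circ]) ∧
      -- (ZZ5): the vertical positions of the decorations are compatible with the
      -- relative order of the nodes labelled `s̃₁` and `s̃ₙ₊₁` in `H(w̃)`:
      d.vorder = l.filterMap fun i =>
        if i.val = 0 then some ((Sum.inl a, Sum.inr b), Deco.btri)
        else if i.val = n then some ((Sum.inl a', Sum.inr b'), Deco.wtri)
        else none

/-! ### The combined decoration map, admissible diagrams and diagram classes -/

/-- `w̃ ∈ (LP) ∪ (RP) ∪ (LRP−Z)`. -/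
def IsPeak (n : ℕ) (w : WC n) : Prop :=
  (∃ J, LPwith n J w) ∨ (∃ K, RPwith n K w) ∨
    (∃ J K, LRPwith n J K w ∧ ¬IsPZZ n w)

/-- `d = dec(w̃)`, where `dec` is `dec_A` on `(ALT)`, `dec_P` on
`(LP) ∪ (RP) ∪ (LRP−Z)` and `dec_Z` on `(ZZ) ∪ (PZZ)`. -/
def DecSpec (n : ℕ) (w : WC n) (d : DecDiagram n) : Prop :=
  (IsALT n w ∧ DecASpec n w d) ∨
  (IsPeak n w ∧ DecPSpec n w d) ∨
  ((IsZZ n w ∨ IsPZZ n w) ∧ DecZSpec n w d)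

/-- Admissible diagrams: by Ernst's theorem these are exactly the images of the
monomial basis under `θ̃`, i.e. the decorated diagrams of fully commutative
elements of type `C̃ₙ`. -/
def Admissible (n : ℕ) (d : DecDiagram n) : Prop :=
  ∃ w : WC n, IsFC (csC n) w ∧ DecSpec n w d

/-- `a(d)`: the number of non-propagating edges in the north face of `d`. -/
noncomputable def aOf (n : ℕ) (d : DecDiagram n) : ℕ :=
  Nat.card {p : Fin (n + 2) × Fin (n + 2) //
    p.1 < p.2 ∧ d.edge (Sum.inl p.1) (Sum.inl p.2)}

/-- A `Z`-diagram. -/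
def ZDiag (n : ℕ) (d : DecDiagram n) : Prop :=
  Admissible n d ∧ aOf n d = 1 ∧
  (∃ a b : Fin (n + 2), d.edge (Sum.inl a) (Sum.inr b) ∧
    (∀ x y, d.edge (Sum.inl x) (Sum.inr y) → a ≤ x) ∧
    Deco.btri ∈ d.decs (Sum.inl a, Sum.inr b)) ∧
  (∃ a b : Fin (n + 2), d.edge (Sum.inl a) (Sum.inr b) ∧
    (∀ x y, d.edge (Sum.inl x) (Sum.inr y) → x ≤ a) ∧
    Deco.wtri ∈ d.decs (Sum.inl a, Sum.inr b))

/-- A `P`-diagram. -/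
def PDiag (n : ℕ) (d : DecDiagram n) : Prop :=
  Admissible n d ∧ ¬ZDiag n d ∧
  ((d.edge (Sum.inl (0 : Fin (n + 2))) (Sum.inr (0 : Fin (n + 2))) ∧
      Deco.btri ∈ d.decs (Sum.inl (0 : Fin (n + 2)), Sum.inr (0 : Fin (n + 2)))) ∨
   (d.edge (Sum.inl (topIdx n)) (Sum.inr (topIdx n)) ∧
      Deco.wtri ∈ d.decs (Sum.inl (topIdx n), Sum.inr (topIdx n))))

/-- An `A`-diagram. -/
def ADiag (n : ℕ) (d : DecDiagram n) : Prop :=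
  Admissible n d ∧ ¬ZDiag n d ∧ ¬PDiag n d

end BCF

namespace BCF

lemma mem_markEnds_aux (m : List ℕ) (x : ℕ) (D E : Deco) (u v : List ℕ) (hu : u ≠ [])
    (hv : v ≠ []) (hm : m = u ++ x :: v) :
    D ∈ markEnds (m.count x) (m.head? = some x) (m.getLast? = some x) D E := by
  have h1 : m.head? = some x → 1 ≤ u.count x := by
    intro h
    cases u with
    | nil => exact absurd rfl hu
    | cons a u' =>
      subst hm
      simp at h
      subst h
      simp
  have h2 : m.getLast? = some x → 1 ≤ v.count x := by
    intro h
    have h3 : v.getLast? = some x := by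
      subst hm
      rw [List.getLast?_append] at h
      cases v with
      | nil => exact absurd rfl hv
      | cons a v' => simpa [List.getLast?_cons_cons] using h
    exact List.one_le_count_iff.2 (List.mem_of_getLast? h3)
  have hc : m.count x = u.count x + v.count x + 1 := by
    subst hm
    simp [List.count_append]
    omega
  unfold markEnds
  rw [List.mem_ofFn]
  by_cases hs : m.head? = some x
  · have := h1 hs
    refine ⟨⟨1, by omega⟩, ?_⟩
    rw [if_neg]
    rintro (⟨h, -⟩ | ⟨h, he⟩)
    · simp at h
    · have := h2 he
      simp only at h
      omega
  · refine ⟨⟨0, by omega⟩, ?_⟩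
    rw [if_neg]
    rintro (⟨-, h⟩ | ⟨h, he⟩)
    · exact hs h
    · have := h2 he
      simp only at h
      omega

lemma zigv_step (n : ℕ) (hn : 2 ≤ n) (t : ℕ) :
    zigv n (t + 1) = zigv n t + 1 ∨ zigv n t = zigv n (t + 1) + 1 := by
  have h0 : t % (2 * n) < 2 * n := Nat.mod_lt _ (by omega)
  have h1 : (t + 1) % (2 * n) = if t % (2 * n) + 1 = 2 * n then 0 else t % (2 * n) + 1 := by
    rw [Nat.add_mod, Nat.mod_eq_of_lt (show 1 < 2 * n by omega)]
    split
    · rename_i h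
      rw [h, Nat.mod_self]
    · rw [Nat.mod_eq_of_lt (by omega)]
  unfold zigv
  rw [h1]
  split_ifs <;> omega

/-- A label constant along the curves of the stacking. -/
def lab {n : ℕ} (l : List (Fin (n + 1))) (c : ℕ → ℕ) (v : ℕ × Fin (n + 2)) : ℤ :=
  if v.1 = 0 then
    (if v.2.val < c 0 then v.2.val else if v.2.val ≤ c 0 + 1 then -1 else (v.2.val : ℤ) - 2)
  else
    (if v.2.val < c (v.1 - 1) then v.2.val
     else if v.2.val ≤ c (v.1 - 1) + 1 then
      (if v.1 < l.length then (min (c (v.1 - 1)) (c v.1) : ℕ) else -2)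
     else (v.2.val : ℤ) - 2)

lemma lab_step {n : ℕ} (l : List (Fin (n + 1))) (c : ℕ → ℕ)
    (hc : ∀ t (h : t < l.length), (l.get ⟨t, h⟩).val = c t)
    (hs : ∀ t, c (t + 1) = c t + 1 ∨ c t = c (t + 1) + 1)
    (a b : ℕ × Fin (n + 2)) (h : LStep n l a b) : lab l c a = lab l c b := by
  cases h with
  | @cupN t p q ht h =>
    unfold cupAt at h
    rw [hc t ht] at h
    unfold lab
    cases t with
    | zero => simp only [if_true]; split_ifs <;> omega
    | succ t =>
      have := hs t
      simp only [Nat.add_sub_cancel, Nat.succ_ne_zero, if_false, if_pos ht]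
      split_ifs <;> omega
  | @capS t p q ht h =>
    unfold cupAt at h
    rw [hc t ht] at h
    unfold lab
    simp only [Nat.add_sub_cancel, Nat.succ_ne_zero, if_false]
    split_ifs <;> omega
  | @vert t p ht h =>
    rw [hc t ht] at h
    unfold lab
    cases t with
    | zero =>
      simp only [Nat.add_sub_cancel, Nat.succ_ne_zero, if_false, if_true]
      split_ifs <;> omega
    | succ t =>
      have := hs t
      simp only [Nat.add_sub_cancel, Nat.succ_ne_zero, if_false, if_pos ht]
      split_ifs <;> omega

lemma lab_conn {n : ℕ} (l : List (Fin (n + 1))) (c : ℕ → ℕ)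
    (hc : ∀ t (h : t < l.length), (l.get ⟨t, h⟩).val = c t)
    (hs : ∀ t, c (t + 1) = c t + 1 ∨ c t = c (t + 1) + 1)
    (a b : ℕ × Fin (n + 2)) (h : Conn n l a b) : lab l c a = lab l c b := by
  unfold Conn at h
  induction h with
  | refl => rfl
  | tail _ h ih =>
    rcases h with h | h
    · rw [ih, lab_step l c hc hs _ _ h]
    · rw [ih, lab_step l c hc hs _ _ h]

lemma aOf_one {n : ℕ} (l : List (Fin (n + 1))) (c : ℕ → ℕ) (h0 : 0 < l.length)
    (hc : ∀ t (h : t < l.length), (l.get ⟨t, h⟩).val = c t)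
    (hs : ∀ t, c (t + 1) = c t + 1 ∨ c t = c (t + 1) + 1)
    (d : DecDiagram n) (hd : ∀ h k, d.edge h k ↔ WordEdge n l h k) : aOf n d = 1 := by
  have hc0 := hc 0 h0
  have hlt := (l.get ⟨0, h0⟩).isLt
  unfold aOf
  rw [Nat.card_eq_one_iff_exists]
  refine ⟨⟨(⟨c 0, by omega⟩, ⟨c 0 + 1, by omega⟩), ?_, ?_⟩, ?_⟩
  · simp [Fin.lt_def]
  · rw [hd]
    refine ⟨by simp, Relation.ReflTransGen.single (Or.inl ?_)⟩
    exact LStep.cupN h0 (Or.inl ⟨hc0.symm, by rw [hc0]⟩)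
  · rintro ⟨⟨p, q⟩, hpq, he⟩
    rw [hd] at he
    have h := lab_conn l c hc hs _ _ he.2
    simp only [bd, lab, if_true] at h
    simp only [Fin.lt_def] at hpq
    have : p.val = c 0 ∧ q.val = c 0 + 1 := by
      split_ifs at h <;> omega
    apply Subtype.ext
    apply Prod.ext
    · exact Fin.ext this.1
    · exact Fin.ext this.2

lemma mod_cases (n t : ℕ) (hn : 2 ≤ n) (i : ℕ) (h : zigv n t = i) :
    t % (2 * n) = i ∨ t % (2 * n) + i = 2 * n := by
  have h0 : t % (2 * n) < 2 * n := Nat.mod_lt _ (by omega)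
  unfold zigv at h
  split_ifs at h <;> omega

lemma exists_hit (n s j x : ℕ) (hj : j ≤ n) (hn : 2 ≤ n) (hs : zigv n s = x) (hx : x ≠ j)
    (hj' : j = 0 ∨ j = n) :
    ∃ r, 0 < r ∧ r < 2 * n ∧ zigv n (s + r) = j := by
  have h0 : s % (2 * n) < 2 * n := Nat.mod_lt _ (by omega)
  have hne : s % (2 * n) ≠ j := by
    intro h
    unfold zigv at hs
    rw [h] at hs
    simp [hj] at hs
    exact hx hs.symm
  refine ⟨if s % (2 * n) < j then j - s % (2 * n) else 2 * n + j - s % (2 * n), ?_, ?_, ?_⟩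
  · split_ifs <;> omega
  · split_ifs <;> omega
  · have : (s + if s % (2 * n) < j then j - s % (2 * n) else 2 * n + j - s % (2 * n)) % (2 * n)
        = j := by
      rw [← Nat.mod_add_mod]
      split_ifs
      · rw [show s % (2 * n) + (j - s % (2 * n)) = j by omega, Nat.mod_eq_of_lt (by omega)]
      · rw [show s % (2 * n) + (2 * n + j - s % (2 * n)) = j + 2 * n by omega,
          Nat.add_mod_right, Nat.mod_eq_of_lt (by omega)]
    unfold zigv
    rw [this, if_pos hj]

lemma far (n a b c i : ℕ) (hn : 2 ≤ n) (hab : a < b) (hbc : b < c)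
    (ha : zigv n a = i) (hb : zigv n b = i) (hc : zigv n c = i) : a + 2 * n ≤ c := by
  by_contra hlt
  have key : ∀ x y, x < y → y < x + 2 * n → x % (2 * n) ≠ y % (2 * n) := by
    intro x y h1 h2 h3
    have := (Nat.modEq_iff_dvd' h1.le).1 h3
    have := Nat.le_of_dvd (by omega) this
    omega
  have k1 := key a b hab (by omega)
  have k2 := key a c (by omega) (by omega)
  have k3 := key b c (by omega) (by omega)
  have := mod_cases n a hn i ha
  have := mod_cases n b hn i hb
  have := mod_cases n c hn i hc
  omega

lemma split_at (m : List ℕ) (t x : ℕ) (h0 : 0 < t) (h1 : t + 1 < m.length)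
    (hx : m[t]'(by omega) = x) : ∃ u v, u ≠ [] ∧ v ≠ [] ∧ m = u ++ x :: v := by
  refine ⟨m.take t, m.drop (t + 1), ?_, ?_, ?_⟩
  · intro h
    have := congrArg List.length h
    rw [List.length_take, List.length_nil] at this
    omega
  · intro h
    have := congrArg List.length h
    simp at this
    omega
  · subst hx
    simp

lemma three_idx (m : List ℕ) (i : ℕ) (h : 3 ≤ m.count i) :
    ∃ (a b c : ℕ) (hab : a < b) (hbc : b < c) (hc : c < m.length),
      m[a]'(by omega) = i ∧ m[b]'(by omega) = i ∧ m[c]'(by omega) = i := by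
  have hs : List.Sublist (List.replicate 3 i) m := List.replicate_sublist_iff.2 h
  obtain ⟨f, hf⟩ := List.sublist_iff_exists_fin_orderEmbedding_get_eq.1 hs
  have e0 := hf ⟨0, by simp⟩
  have e1 := hf ⟨1, by simp⟩
  have e2 := hf ⟨2, by simp⟩
  have l1 : f ⟨0, by simp⟩ < f ⟨1, by simp⟩ := f.strictMono (by simp [Fin.lt_def])
  have l2 : f ⟨1, by simp⟩ < f ⟨2, by simp⟩ := f.strictMono (by simp [Fin.lt_def])
  refine ⟨_, _, _, l1, l2, (f ⟨2, by simp⟩).isLt, ?_, ?_, ?_⟩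
  · simpa using e0.symm
  · simpa using e1.symm
  · simpa using e2.symm

lemma zz_core (n : ℕ) (hn : 2 ≤ n) (w : WC n) (hw : IsZZ n w ∨ IsPZZ n w) :
    ∃ l, (csC n).IsReduced l ∧ (csC n).wordProd l = w ∧ IsZigWord n l ∧
      (∃ u v, u ≠ [] ∧ v ≠ [] ∧ l.map Fin.val = u ++ 0 :: v) ∧
      (∃ u v, u ≠ [] ∧ v ≠ [] ∧ l.map Fin.val = u ++ n :: v) := by
  rcases hw with ⟨-, l, h1, h2, h3, i, hi1, hi2, hi3⟩ | ⟨-, l, h1, h2, h3, -, ⟨u, v, h4⟩, u', v', h5⟩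
  · refine ⟨l, h1, h2, h3, ?_⟩
    obtain ⟨k, hk⟩ := h3
    obtain ⟨a, b, c, hab, hbc, hc, ea, eb, ec⟩ := three_idx _ i hi3
    have hz : ∀ t (h : t < (l.map Fin.val).length), (l.map Fin.val)[t] = zigv n (k + t) := by
      intro t h
      simp only [hk]
      simp
    rw [hz] at ea eb ec
    have hfar := far n (k + a) (k + b) (k + c) i hn (by omega) (by omega) ea eb ec
    have main : ∀ j, (j = 0 ∨ j = n) →
        ∃ u v, u ≠ [] ∧ v ≠ [] ∧ l.map Fin.val = u ++ j :: v := by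
      intro j hj
      obtain ⟨r, hr0, hr1, hr2⟩ := exists_hit n (k + a) j i (by omega) hn ea (by omega) hj
      refine split_at _ (a + r) j (by omega) (by omega) ?_
      rw [hz, ← hr2, Nat.add_assoc]
    exact ⟨main 0 (Or.inl rfl), main n (Or.inr rfl)⟩
  · refine ⟨l, h1, h2, h3, ⟨u ++ [1], 1 :: v, by simp, by simp, by simp [h4]⟩,
      ⟨u' ++ [n - 1], (n - 1) :: v', by simp, by simp, by simp [h5]⟩⟩

/-- Let `w̃ ∈ (ZZ)` or `(PZZ)` and `d = dec_Z(w̃)`.  Then `d` is a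
decorated diagram with `a(d) = 1`, and `d` has at least one `▲` on the first
propagating edge and at least one `△` on the last propagating edge. -/
theorem statement15 (n : ℕ) (hn : 2 ≤ n) (w : WC n)
    (hw : IsZZ n w ∨ IsPZZ n w)
    (d : DecDiagram n) (hd : DecZSpec n w d) :
    aOf n d = 1 ∧
    (∃ a b : Fin (n + 2), d.edge (Sum.inl a) (Sum.inr b) ∧
      (∀ x y, d.edge (Sum.inl x) (Sum.inr y) → a ≤ x) ∧
      Deco.btri ∈ d.decs (Sum.inl a, Sum.inr b)) ∧
    (∃ a b : Fin (n + 2), d.edge (Sum.inl a) (Sum.inr b) ∧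
      (∀ x y, d.edge (Sum.inl x) (Sum.inr y) → x ≤ a) ∧
      Deco.wtri ∈ d.decs (Sum.inl a, Sum.inr b)) := by
  obtain ⟨l, h1, h2, ⟨k, hk⟩, ⟨u, v, hu, hv, huv⟩, ⟨u', v', hu', hv', huv'⟩⟩ := zz_core n hn w hw
  obtain ⟨he, -, a, b, a', b', e1, e2, e3, e4, d1, d2, -⟩ := hd l h1 h2
  refine ⟨?_, ⟨a, b, e1, e2, ?_⟩, ⟨a', b', e3, e4, ?_⟩⟩
  · refine aOf_one l (fun t => zigv n (k + t)) ?_ ?_ (fun t => zigv_step n hn (k + t)) d he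
    · rw [← List.length_map (as := l) Fin.val, huv]
      simp
    · intro t h
      have hz : (l.map Fin.val)[t]'(by simpa using h) = zigv n (k + t) := by
        simp only [hk]
        simp
      simpa using hz
  · rw [d1]
    exact mem_markEnds_aux _ _ _ _ u v hu hv huv
  · rw [d2]
    exact mem_markEnds_aux _ _ _ _ u' v' hu' hv' huv'

end BCF
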